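/- arXiv:2507.05059 — 4 statements merged into one kernel-verified Lean document; each statement's English description precedes it below -/
import Mathlib

section
/- Let n ∈ ℤ and let k : [0,∞) → ℝ be a smooth function which is nonvanishing, has a finite nonzero limit as β → ∞, and satisfies k(β) ≠ 0 for every β ≥ 0. Suppose f : [0,∞) → ℂ is continuous, has a finite limit as β → ∞, is differentiable on (0,∞), and satisfies −βf'(β) + (inβ + k(β))f(β) = 0 for all β > 0. Then f ≡ 0. -/
open Filter Topology

/-- A continuous function on `[0,∞)` that is positive and has a nonzero limit at infinity is
bounded below by a positive constant. -/
lemma exists_pos_le_of_tendsto {k : ℝ → ℝ} {L : ℝ} (hk : ContinuousOn k (Set.Ici 0))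
    (hL : L ≠ 0) (hlim : Tendsto k atTop (𝓝 L)) (hpos : ∀ β, 0 ≤ β → 0 < k β) :
    ∃ c, 0 < c ∧ ∀ β, 0 ≤ β → c ≤ k β := by
  have hL0 : 0 < L := lt_of_le_of_ne
    (ge_of_tendsto hlim ((eventually_ge_atTop 0).mono fun β hβ => (hpos β hβ).le)) hL.symm
  obtain ⟨B, hB⟩ := eventually_atTop.1 (hlim.eventually_const_le (half_lt_self hL0))
  obtain ⟨x, hx, hmin⟩ := isCompact_Icc.exists_isMinOn
    (Set.nonempty_Icc.2 (le_max_left 0 B)) (hk.mono Set.Icc_subset_Ici_self)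
  refine ⟨min (L / 2) (k x), lt_min (half_pos hL0) (hpos x hx.1), fun β hβ => ?_⟩
  rcases le_total β (max 0 B) with h | h
  · exact (min_le_right _ _).trans (hmin ⟨hβ, h⟩)
  · exact (min_le_left _ _).trans (hB β ((le_max_right _ _).trans h))

/-- A continuous nonvanishing function on `[0,∞)` has constant sign. -/
lemma forall_pos_or_forall_neg {k : ℝ → ℝ} (hk : ContinuousOn k (Set.Ici 0))
    (hne : ∀ β, 0 ≤ β → k β ≠ 0) :
    (∀ β, 0 ≤ β → 0 < k β) ∨ (∀ β, 0 ≤ β → 0 < -k β) := by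
  by_contra! h
  obtain ⟨⟨a, ha, hka⟩, b, hb, hkb⟩ := h
  obtain ⟨x, hx, hx0⟩ := isPreconnected_Ici.intermediate_value (Set.mem_Ici.2 ha)
    (Set.mem_Ici.2 hb) hk ⟨hka, by linarith⟩
  exact hne x hx hx0

/-- The derivative of `β ^ (-2c) ‖f β‖²` along a solution of `β f' = (i m β + κ) f`. -/
lemma hasDerivAt_rpow_mul_norm_sq {f : ℝ → ℂ} {m κ β : ℝ} (c : ℝ) (hβ : 0 < β)
    (hf : DifferentiableAt ℝ f β)
    (heq : -(β : ℂ) * deriv f β + ((m : ℂ) * (β : ℂ) * Complex.I + (κ : ℂ)) * f β = 0) :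
    HasDerivAt (fun x => x ^ (-2 * c) * ‖f x‖ ^ 2)
      (2 * β ^ (-2 * c - 1) * (κ - c) * ‖f β‖ ^ 2) β := by
  have hβ0 : (β : ℂ) ≠ 0 := by exact_mod_cast hβ.ne'
  have hd : deriv f β = ((κ / β : ℝ) + (m : ℂ) * Complex.I) * f β := by
    push_cast
    field_simp
    linear_combination -heq
  have hinner : inner ℝ (f β) (deriv f β) = κ / β * ‖f β‖ ^ 2 := by
    rw [hd, Complex.inner, Complex.sq_norm, Complex.normSq_apply]
    simp
    ring
  have h := (Real.hasDerivAt_rpow_const (p := -2 * c) (Or.inl hβ.ne')).mul hf.hasDerivAt.norm_sq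
  refine h.congr_deriv ?_
  rw [hinner, Real.rpow_sub_one hβ.ne']
  field_simp
  ring

/-- Injectivity of the operator `-D_β + i n β + k(β)` on the space `𝒞`
of continuous functions on `[0,∞)` with a finite limit at infinity. -/
theorem stmt_2 (n : ℤ) (k : ℝ → ℝ)
    (hk_smooth : ContDiffOn ℝ (⊤ : ℕ∞) k (Set.Ici 0))
    (hk_lim : ∃ L : ℝ, L ≠ 0 ∧ Tendsto k atTop (nhds L))
    (hk_ne : ∀ β : ℝ, 0 ≤ β → k β ≠ 0)
    (f : ℝ → ℂ)
    (hf_cont : ContinuousOn f (Set.Ici 0))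
    (hf_lim : ∃ M : ℂ, Tendsto f atTop (nhds M))
    (hf_diff : ∀ β : ℝ, 0 < β → DifferentiableAt ℝ f β)
    (hf_eq : ∀ β : ℝ, 0 < β →
      -(β : ℂ) * deriv f β + ((n : ℂ) * (β : ℂ) * Complex.I + (k β : ℂ)) * f β = 0) :
    ∀ β : ℝ, 0 ≤ β → f β = 0 := by
  obtain ⟨L, hL, hkL⟩ := hk_lim
  obtain ⟨M, hM⟩ := hf_lim
  have hk := hk_smooth.continuousOn
  have hf0 : Tendsto f (𝓝[>] 0) (𝓝 (f 0)) :=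
    (hf_cont 0 Set.self_mem_Ici).mono_left (nhdsWithin_mono _ Set.Ioi_subset_Ici_self)
  have hderiv (c β : ℝ) (hβ : 0 < β) := hasDerivAt_rpow_mul_norm_sq (m := n) c hβ (hf_diff β hβ)
    (by exact_mod_cast hf_eq β hβ)
  have hcont (c : ℝ) : ContinuousOn (fun x => x ^ (-2 * c) * ‖f x‖ ^ 2) (Set.Ioi 0) :=
    fun x hx => (hderiv c x hx).continuousAt.continuousWithinAt
  have hzero (c β : ℝ) (hβ : 0 < β) (h : β ^ (-2 * c) * ‖f β‖ ^ 2 ≤ 0) : f β = 0 := by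
    have := nonpos_of_mul_nonpos_right h (Real.rpow_pos_of_pos hβ _)
    simpa using le_antisymm this (sq_nonneg _)
  have hpos : ∀ β, 0 < β → f β = 0 := by
    rcases forall_pos_or_forall_neg hk hk_ne with hs | hs
    · obtain ⟨c, hc, hck⟩ := exists_pos_le_of_tendsto hk hL hkL hs
      have hmono : MonotoneOn (fun x => x ^ (-2 * c) * ‖f x‖ ^ 2) (Set.Ioi 0) := by
        refine monotoneOn_of_hasDerivWithinAt_nonneg (convex_Ioi 0) (hcont c)
          (fun x hx => (hderiv c x (interior_subset hx)).hasDerivWithinAt) fun x hx => ?_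
        have hx0 : 0 < x := interior_subset hx
        have := sub_nonneg.2 (hck x hx0.le)
        positivity
      have hlim : Tendsto (fun x => x ^ (-2 * c) * ‖f x‖ ^ 2) atTop (𝓝 0) := by
        simpa using (tendsto_rpow_neg_atTop (y := 2 * c) (by positivity)).mul (hM.norm.pow 2)
      refine fun β hβ => hzero c β hβ (ge_of_tendsto hlim ?_)
      filter_upwards [eventually_ge_atTop β] with x hx
      exact hmono hβ (hβ.trans_le hx) hx
    · obtain ⟨c, hc, hck⟩ := exists_pos_le_of_tendsto hk.neg (neg_ne_zero.2 hL) hkL.neg hs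
      have hanti : AntitoneOn (fun x => x ^ (-2 * -c) * ‖f x‖ ^ 2) (Set.Ioi 0) := by
        refine antitoneOn_of_hasDerivWithinAt_nonpos (convex_Ioi 0) (hcont (-c))
          (fun x hx => (hderiv (-c) x (interior_subset hx)).hasDerivWithinAt) fun x hx => ?_
        have hx0 : 0 < x := interior_subset hx
        have : k x - -c ≤ 0 := by linarith [hck x hx0.le, Pi.neg_apply k x]
        exact mul_nonpos_of_nonpos_of_nonneg
          (mul_nonpos_of_nonneg_of_nonpos (by positivity) this) (by positivity)
      have hlim : Tendsto (fun x => x ^ (-2 * -c) * ‖f x‖ ^ 2) (𝓝[>] 0) (𝓝 0) := by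
        have hp : 0 < -2 * -c := by linarith
        have := ((Real.continuousAt_rpow_const 0 _ (Or.inr hp.le)).tendsto.mono_left
          nhdsWithin_le_nhds).mul (hf0.norm.pow 2)
        rwa [Real.zero_rpow hp.ne', zero_mul] at this
      refine fun β hβ => hzero (-c) β hβ (ge_of_tendsto hlim ?_)
      filter_upwards [Ioc_mem_nhdsGT hβ] with x hx
      exact hanti hx.1 hβ hx.2
  intro β hβ
  rcases hβ.eq_or_lt with rfl | h
  · exact tendsto_nhds_unique hf0 (tendsto_const_nhds.congr'
      (eventually_mem_nhdsWithin.mono fun x hx => (hpos x hx).symm))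
  · exact hpos β h
end

section
/- There exists a constant C = C(μ, δ, η) > 0 such that for every n ∈ ℤ∖{0}: a_n ∈ 𝒞^δ with ‖a_n‖_{𝒞^δ} ≤ C|n|, χ_n ∈ 𝒞^δ with ‖χ_n‖_{𝒞^δ} ≤ C, and the function β ↦ βχ_n'(β) belongs to 𝒞^δ with ‖βχ_n'‖_{𝒞^δ} ≤ C. -/
open Filter Topology Set

/-- sup norm over `[0,∞)` (real-valued functions). -/
noncomputable def supNR (f : ℝ → ℝ) : ℝ := ⨆ β : Ici (0 : ℝ), |f (β : ℝ)|

/-- weighted seminorm `sup_{β>0} β^δ |f(β) − L|`. -/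
noncomputable def hoelR (δ : ℝ) (f : ℝ → ℝ) (L : ℝ) : ℝ :=
  ⨆ β : Ioi (0 : ℝ), (β : ℝ) ^ δ * |f (β : ℝ) - L|

/-- the `𝒞^δ` norm, with `L = f(∞)`. -/
noncomputable def normCR (δ : ℝ) (f : ℝ → ℝ) (L : ℝ) : ℝ := supNR f + hoelR δ f L

/-- membership in `𝒞^δ`, with limit value `L` at infinity. -/
def MemCdeltaR (δ : ℝ) (f : ℝ → ℝ) (L : ℝ) : Prop :=
  ContinuousOn f (Ici 0) ∧ Tendsto f atTop (nhds L) ∧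
    BddAbove (Set.range fun β : Ioi (0 : ℝ) => (β : ℝ) ^ δ * |f (β : ℝ) - L|)

/-- `a_n(β) = √(n²μ² − (2μ−1)η(β))`. -/
noncomputable def aFun (μ : ℝ) (η : ℝ → ℝ) (n : ℤ) (β : ℝ) : ℝ :=
  Real.sqrt ((n : ℝ) ^ 2 * μ ^ 2 - (2 * μ - 1) * η β)

/-- `χ_n(β) = η(β) − βη'(β)/(2a_n(β))`. -/
noncomputable def chiFun (μ : ℝ) (η : ℝ → ℝ) (n : ℤ) (β : ℝ) : ℝ :=
  η β - β * deriv η β / (2 * aFun μ η n β)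

/-- A continuous function on `[0,∞)` which is constant from `2` on and bounded by `M` lies in
`𝒞^δ`, with norm at most `5 M`, if `0 < δ ≤ 1`. -/
theorem memCdeltaR_and_normCR_le {δ M L : ℝ} {f : ℝ → ℝ} (hδ0 : 0 < δ) (hδ1 : δ ≤ 1)
    (hf : ContinuousOn f (Ici 0)) (hfL : ∀ β, 2 ≤ β → f β = L)
    (hfM : ∀ β, 0 ≤ β → |f β| ≤ M) :
    MemCdeltaR δ f L ∧ normCR δ f L ≤ 5 * M := by
  have hLM : |L| ≤ M := hfL 2 le_rfl ▸ hfM 2 zero_le_two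
  have hM : 0 ≤ M := (abs_nonneg L).trans hLM
  have key : ∀ β : Ioi (0 : ℝ), (β : ℝ) ^ δ * |f β - L| ≤ 4 * M := by
    rintro ⟨β, hβ⟩
    have hβ : 0 < β := hβ
    change β ^ δ * |f β - L| ≤ 4 * M
    rcases le_total 2 β with h | h
    · rw [hfL β h]
      simpa using hM
    · have h1 : β ^ δ ≤ 2 :=
        calc β ^ δ ≤ 2 ^ δ := Real.rpow_le_rpow hβ.le h hδ0.le
          _ ≤ 2 ^ (1 : ℝ) := Real.rpow_le_rpow_of_exponent_le one_le_two hδ1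
          _ = 2 := Real.rpow_one 2
      have h2 : |f β - L| ≤ 2 * M := by
        linarith [abs_sub (f β) L, hfM β hβ.le]
      calc β ^ δ * |f β - L| ≤ 2 * (2 * M) := mul_le_mul h1 h2 (abs_nonneg _) zero_le_two
        _ = 4 * M := by ring
  refine ⟨⟨hf, ?_, 4 * M, ?_⟩, ?_⟩
  · refine tendsto_const_nhds.congr' ?_
    filter_upwards [eventually_ge_atTop 2] with β hβ using (hfL β hβ).symm
  · rintro _ ⟨β, rfl⟩
    exact key β
  · have h1 : supNR f ≤ M := Real.iSup_le (fun β => hfM β β.2) hM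
    have h2 : hoelR δ f L ≤ 4 * M := Real.iSup_le key (by positivity)
    unfold normCR
    linarith

/-- A differentiable function that is constant on `[b,∞)` has zero derivative there. -/
theorem deriv_eq_zero_of_eq_const_of_le {f : ℝ → ℝ} {b c x : ℝ} (hf : DifferentiableAt ℝ f x)
    (hc : ∀ y, b ≤ y → f y = c) (hx : b ≤ x) : deriv f x = 0 := by
  have hu : UniqueDiffWithinAt ℝ (Ici b) x := uniqueDiffOn_Ici b x hx
  rw [← hf.derivWithin hu,
    derivWithin_congr (s := Ici b) (f := fun _ => c) (fun y hy => hc y hy) (hc x hx)]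
  simp

section CutoffBounds

variable {μ : ℝ} {η : ℝ → ℝ} {n : ℤ}

theorem sq_sub_one_le_radicand (hμ : 1 < μ) (hη : ∀ β, 0 ≤ η β ∧ η β ≤ 1) (hn : n ≠ 0) (β : ℝ) :
    (μ - 1) ^ 2 ≤ (n : ℝ) ^ 2 * μ ^ 2 - (2 * μ - 1) * η β := by
  have h1 : (1 : ℝ) ≤ (n : ℝ) ^ 2 := by
    exact_mod_cast Int.one_le_abs (pow_ne_zero 2 hn) |>.trans_eq (abs_of_nonneg (sq_nonneg n))
  nlinarith [(hη β).2, mul_le_mul_of_nonneg_right h1 (sq_nonneg μ)]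

theorem sub_one_le_aFun (hμ : 1 < μ) (hη : ∀ β, 0 ≤ η β ∧ η β ≤ 1) (hn : n ≠ 0) (β : ℝ) :
    μ - 1 ≤ aFun μ η n β :=
  Real.le_sqrt_of_sq_le (sq_sub_one_le_radicand hμ hη hn β)

theorem aFun_le (hμ : 1 < μ) (hη : ∀ β, 0 ≤ η β ∧ η β ≤ 1) (β : ℝ) :
    aFun μ η n β ≤ μ * |(n : ℝ)| := by
  refine Real.sqrt_le_iff.2 ⟨by positivity, ?_⟩
  rw [mul_pow, sq_abs]
  nlinarith [(hη β).1]

theorem hasDerivAt_aFun (hμ : 1 < μ) (hη : ∀ β, 0 ≤ η β ∧ η β ≤ 1) (hn : n ≠ 0) {β : ℝ}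
    (hd : DifferentiableAt ℝ η β) :
    HasDerivAt (aFun μ η n) (-((2 * μ - 1) * deriv η β) / (2 * aFun μ η n β)) β := by
  have hpos : 0 < (n : ℝ) ^ 2 * μ ^ 2 - (2 * μ - 1) * η β :=
    (pow_pos (sub_pos.2 hμ) 2).trans_le (sq_sub_one_le_radicand hμ hη hn β)
  exact ((hd.hasDerivAt.const_mul (2 * μ - 1)).const_sub ((n : ℝ) ^ 2 * μ ^ 2)).sqrt hpos.ne'

theorem hasDerivAt_chiFun (hμ : 1 < μ) (hη : ∀ β, 0 ≤ η β ∧ η β ≤ 1) (hn : n ≠ 0) {β : ℝ}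
    (hd : DifferentiableAt ℝ η β) (hd2 : DifferentiableAt ℝ (deriv η) β) :
    HasDerivAt (chiFun μ η n)
      (deriv η β - (deriv η β + β * deriv (deriv η) β) / (2 * aFun μ η n β)
        - (2 * μ - 1) * β * deriv η β ^ 2 / (4 * aFun μ η n β ^ 3)) β := by
  have ha : 0 < aFun μ η n β := (sub_pos.2 hμ).trans_le (sub_one_le_aFun hμ hη hn β)
  have h := hd.hasDerivAt.sub (((hasDerivAt_id β).mul hd2.hasDerivAt).div
    ((hasDerivAt_aFun hμ hη hn hd).const_mul 2) (by positivity))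
  refine h.congr_deriv ?_
  simp only [id, Pi.mul_apply]
  field_simp
  ring

end CutoffBounds

/-- Uniform-in-`n` bounds: `‖a_n‖_{𝒞^δ} ≤ C|n|`, `‖χ_n‖_{𝒞^δ} ≤ C`,
`‖βχ_n'‖_{𝒞^δ} ≤ C`. -/
theorem stmt_4 (μ δ : ℝ) (hμ : 1 < μ)
    (hδ0 : 0 < δ)
    (hδ1 : δ < min (Real.sqrt (4 * μ ^ 2 - 2 * μ + 1) - 2 * μ + 1) 1)
    (η : ℝ → ℝ) (hη_smooth : ContDiff ℝ (⊤ : ℕ∞) η)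
    (hη_range : ∀ β, 0 ≤ η β ∧ η β ≤ 1)
    (hη0 : ∀ β : ℝ, β ≤ 1 → η β = 0) (hη1 : ∀ β : ℝ, 2 ≤ β → η β = 1) :
    ∃ C : ℝ, 0 < C ∧ ∀ n : ℤ, n ≠ 0 →
      (MemCdeltaR δ (aFun μ η n) (Real.sqrt ((n : ℝ) ^ 2 * μ ^ 2 - 2 * μ + 1)) ∧
        normCR δ (aFun μ η n) (Real.sqrt ((n : ℝ) ^ 2 * μ ^ 2 - 2 * μ + 1)) ≤ C * |(n : ℝ)|) ∧
      (MemCdeltaR δ (chiFun μ η n) 1 ∧ normCR δ (chiFun μ η n) 1 ≤ C) ∧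
      (MemCdeltaR δ (fun β => β * deriv (chiFun μ η n) β) 0 ∧
        normCR δ (fun β => β * deriv (chiFun μ η n) β) 0 ≤ C) := by
  have hδ1' : δ ≤ 1 := (hδ1.trans_le (min_le_right _ _)).le
  have hη2 : ContDiff ℝ 2 η := by exact_mod_cast contDiff_infty.1 hη_smooth 2
  have hd : Differentiable ℝ η := hη2.differentiable (by norm_num)
  have hη' : ContDiff ℝ 1 (deriv η) := ContDiff.deriv' (by simpa [one_add_one_eq_two] using hη2)
  have hd2 : Differentiable ℝ (deriv η) := hη'.differentiable (by norm_num)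
  have hc1 : Continuous (deriv η) := hd2.continuous
  have hc2 : Continuous (deriv (deriv η)) := hη'.continuous_deriv (by norm_num)
  obtain ⟨D₁, hD₁⟩ := (isCompact_Icc (a := (0 : ℝ)) (b := 2)).exists_bound_of_continuousOn
    hc1.continuousOn
  obtain ⟨D₂, hD₂⟩ := (isCompact_Icc (a := (0 : ℝ)) (b := 2)).exists_bound_of_continuousOn
    hc2.continuousOn
  simp only [Real.norm_eq_abs] at hD₁ hD₂
  have hD₁0 : 0 ≤ D₁ := (abs_nonneg _).trans (hD₁ 0 (by simp))
  have hD₂0 : 0 ≤ D₂ := (abs_nonneg _).trans (hD₂ 0 (by simp))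
  have hm : 0 < μ - 1 := sub_pos.2 hμ
  have hμ' : 0 < 2 * μ - 1 := by linarith
  set M₁ : ℝ := 1 + 2 * D₁ / (2 * (μ - 1)) with hM₁
  set M₂ : ℝ := 2 * (D₁ + (D₁ + 2 * D₂) / (2 * (μ - 1))
    + (2 * μ - 1) * 2 * D₁ ^ 2 / (4 * (μ - 1) ^ 3)) with hM₂
  have hM₁0 : 0 ≤ M₁ := by positivity
  have hM₂0 : 0 ≤ M₂ := by positivity
  refine ⟨5 * (μ + M₁ + M₂), by positivity, fun n hn => ?_⟩
  have ha := sub_one_le_aFun hμ hη_range hn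
  have ha0 : ∀ β, 0 < aFun μ η n β := fun β => hm.trans_le (ha β)
  have hac : Continuous (aFun μ η n) := continuous_iff_continuousAt.2 fun β =>
    (hasDerivAt_aFun hμ hη_range hn (hd β)).continuousAt
  have hχd : ∀ β, HasDerivAt (chiFun μ η n) _ β := fun β =>
    hasDerivAt_chiFun hμ hη_range hn (hd β) (hd2 β)
  have hχ1 : ∀ β, 2 ≤ β → chiFun μ η n β = 1 := fun β hβ => by
    simp [chiFun, hη1 β hβ, deriv_eq_zero_of_eq_const_of_le (hd β) hη1 hβ]
  have hA := memCdeltaR_and_normCR_le (M := μ * |(n : ℝ)|)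
    (L := Real.sqrt ((n : ℝ) ^ 2 * μ ^ 2 - 2 * μ + 1)) hδ0 hδ1' hac.continuousOn
    (fun β hβ => by rw [aFun, hη1 β hβ]; ring_nf)
    (fun β _ => (abs_of_pos (ha0 β)).trans_le (aFun_le hμ hη_range β))
  have hX := memCdeltaR_and_normCR_le (M := M₁) (L := 1) (f := chiFun μ η n) hδ0 hδ1'
    (fun β _ => (hχd β).continuousAt.continuousWithinAt) hχ1 (fun β hβ => by
      rcases le_total 2 β with h | h
      · rw [hχ1 β h, abs_one, hM₁]
        exact le_add_of_nonneg_right (by positivity)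
      · refine (abs_sub _ _).trans (add_le_add ?_ ?_)
        · rw [abs_of_nonneg (hη_range β).1]
          exact (hη_range β).2
        · rw [abs_div, abs_mul, abs_of_nonneg hβ, abs_of_pos (mul_pos two_pos (ha0 β))]
          have := hD₁ β ⟨hβ, h⟩
          have := ha β
          gcongr)
  have hY := memCdeltaR_and_normCR_le (M := M₂) (L := 0)
    (f := fun β => β * deriv (chiFun μ η n) β) hδ0 hδ1' (by
      simp only [fun β => (hχd β).deriv]
      refine Continuous.continuousOn ?_
      have h1 : ∀ β, 2 * aFun μ η n β ≠ 0 := fun β => (mul_pos two_pos (ha0 β)).ne'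
      have h2 : ∀ β, 4 * aFun μ η n β ^ 3 ≠ 0 := fun β => by
        have := ha0 β
        positivity
      fun_prop (disch := assumption))
    (fun β hβ => by
      simp [deriv_eq_zero_of_eq_const_of_le (hχd β).differentiableAt hχ1 hβ])
    (fun β hβ => by
      rcases le_total 2 β with h | h
      · simpa [deriv_eq_zero_of_eq_const_of_le (hχd β).differentiableAt hχ1 h] using hM₂0
      · simp only [(hχd β).deriv]
        have h1 := hD₁ β ⟨hβ, h⟩
        have h2 := hD₂ β ⟨hβ, h⟩
        have h3 := ha β
        have h4 := ha0 β
        rw [abs_mul, abs_of_nonneg hβ, hM₂]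
        refine mul_le_mul h ?_ (abs_nonneg _) zero_le_two
        refine (abs_sub _ _).trans (add_le_add ((abs_sub _ _).trans (add_le_add h1 ?_)) ?_)
        · rw [abs_div, abs_of_pos (mul_pos two_pos h4)]
          have h5 : |deriv η β + β * deriv (deriv η) β| ≤ D₁ + 2 * D₂ := by
            refine (abs_add_le _ _).trans (add_le_add h1 ?_)
            rw [abs_mul, abs_of_nonneg hβ]
            gcongr
          gcongr
        · rw [abs_of_nonneg (by positivity), ← sq_abs (deriv η β)]
          gcongr)
  have hn0 : 1 ≤ |(n : ℝ)| := by exact_mod_cast Int.one_le_abs hn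
  refine ⟨⟨hA.1, hA.2.trans ?_⟩, ⟨hX.1, hX.2.trans ?_⟩, ⟨hY.1, hY.2.trans ?_⟩⟩
  · rw [← mul_assoc]
    gcongr
    linarith
  · linarith
  · linarith
end

section
/- For every n ∈ ℤ∖{0}, let C_n = exp(∫_1^2 (a_n(b) − √(n²μ² − 2μ + 1)) b^{−1} db), so that W_n(β) = C_n β^{√(n²μ²−2μ+1)} for β ≥ 2. Then: (i) 1 ≤ C_n ≤ 2; (ii) β^{√(n²μ²−2μ+1)} ≤ W_n(β) ≤ 2β^{√(n²μ²−2μ+1)} for all β ≥ 1; (iii) (1/2)β^{|n|μ} ≤ W_n(β) ≤ β^{|n|μ} for all 0 < β ≤ 2. -/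
open Filter Topology Set intervalIntegral

/-- `W_n(β) = exp(∫_1^β a_n(b)/b db)`. -/
noncomputable def WFun (μ : ℝ) (η : ℝ → ℝ) (n : ℤ) (β : ℝ) : ℝ :=
  Real.exp (∫ b in (1 : ℝ)..β, aFun μ η n b / b)

/-- `C_n = exp(∫_1^2 (a_n(b) − √(n²μ²−2μ+1))/b db)`. -/
noncomputable def CConst (μ : ℝ) (η : ℝ → ℝ) (n : ℤ) : ℝ :=
  Real.exp (∫ b in (1 : ℝ)..(2 : ℝ),
    (aFun μ η n b - Real.sqrt ((n : ℝ) ^ 2 * μ ^ 2 - 2 * μ + 1)) / b)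

lemma intervalIntegrable_div_id {f : ℝ → ℝ} (hf : Continuous f) {a b : ℝ} (ha : 0 < a)
    (hb : 0 < b) : IntervalIntegrable (fun x => f x / x) MeasureTheory.volume a b := by
  refine ContinuousOn.intervalIntegrable (hf.continuousOn.div continuousOn_id ?_)
  intro x hx
  exact (lt_of_lt_of_le (lt_min ha hb) hx.1).ne'

lemma integral_const_div_id (c : ℝ) {b : ℝ} (hb : 0 < b) :
    ∫ x in (1 : ℝ)..b, c / x = c * Real.log b := by
  simp only [div_eq_mul_inv]
  rw [intervalIntegral.integral_const_mul, integral_inv_of_pos one_pos hb, div_one]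

lemma continuous_aFun (μ : ℝ) {η : ℝ → ℝ} (hη : Continuous η) (n : ℤ) :
    Continuous (aFun μ η n) := by
  unfold aFun
  fun_prop

lemma WFun_eq_exp_mul_rpow (μ : ℝ) {η : ℝ → ℝ} (hη : Continuous η) (n : ℤ) (c : ℝ) {β : ℝ}
    (hβ : 0 < β) :
    WFun μ η n β = Real.exp (∫ b in (1 : ℝ)..β, (aFun μ η n b - c) / b) * β ^ c := by
  have ha := continuous_aFun μ hη n
  have h : (∫ b in (1 : ℝ)..β, (aFun μ η n b - c) / b)
      = (∫ b in (1 : ℝ)..β, aFun μ η n b / b) - c * Real.log β := by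
    simp only [sub_div]
    rw [intervalIntegral.integral_sub (intervalIntegrable_div_id ha one_pos hβ)
      (intervalIntegrable_div_id continuous_const one_pos hβ), integral_const_div_id c hβ]
  rw [h, Real.rpow_def_of_pos hβ, ← Real.exp_add, WFun]
  congr 1
  ring

/-- Pointwise bounds `l ≤ f ≤ u` on `[1, b]` bound `∫_1^b f(x)/x dx`. -/
lemma integral_div_id_mem_Icc {f : ℝ → ℝ} (hf : Continuous f) {l u b : ℝ} (hb : 1 ≤ b)
    (h : ∀ x, f x ∈ Icc l u) :
    (∫ x in (1 : ℝ)..b, f x / x) ∈ Icc (l * Real.log b) (u * Real.log b) := by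
  have hb0 : 0 < b := by linarith
  have hi := intervalIntegrable_div_id hf one_pos hb0
  rw [← integral_const_div_id l hb0, ← integral_const_div_id u hb0]
  constructor
  · refine integral_mono_on hb (intervalIntegrable_div_id continuous_const one_pos hb0) hi ?_
    intro x hx
    have hx0 : 0 ≤ x := by linarith [hx.1]
    exact div_le_div_of_nonneg_right (h x).1 hx0
  · refine integral_mono_on hb hi (intervalIntegrable_div_id continuous_const one_pos hb0) ?_
    intro x hx
    have hx0 : 0 ≤ x := by linarith [hx.1]
    exact div_le_div_of_nonneg_right (h x).2 hx0

lemma abs_mul_le_sqrt_add_one {μ : ℝ} (hμ : 1 < μ) {n : ℤ} (hn : n ≠ 0) :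
    |(n : ℝ)| * μ ≤ Real.sqrt ((n : ℝ) ^ 2 * μ ^ 2 - 2 * μ + 1) + 1 := by
  have hn1 : (1 : ℝ) ≤ |(n : ℝ)| := by exact_mod_cast Int.one_le_abs hn
  have h : |(n : ℝ)| * μ - 1 ≤ Real.sqrt ((n : ℝ) ^ 2 * μ ^ 2 - 2 * μ + 1) := by
    apply Real.le_sqrt_of_sq_le
    rw [← sq_abs (n : ℝ)]
    nlinarith
  linarith

lemma aFun_mem_Icc {μ : ℝ} (hμ : 1 < μ) {η : ℝ → ℝ} (n : ℤ) {β : ℝ}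
    (hη : 0 ≤ η β ∧ η β ≤ 1) :
    aFun μ η n β ∈ Icc (Real.sqrt ((n : ℝ) ^ 2 * μ ^ 2 - 2 * μ + 1)) (|(n : ℝ)| * μ) := by
  constructor
  · apply Real.sqrt_le_sqrt
    nlinarith [hη.2]
  · apply Real.sqrt_le_iff.mpr
    refine ⟨by positivity, ?_⟩
    rw [mul_pow, sq_abs]
    nlinarith [hη.1]

/-- Bounds on the weights `W_n`:
`W_n(β) = C_n β^√(n²μ²−2μ+1)` for `β ≥ 2` with `1 ≤ C_n ≤ 2`,
`β^√(n²μ²−2μ+1) ≤ W_n(β) ≤ 2β^√(n²μ²−2μ+1)` for `β ≥ 1`, and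
`(1/2)β^{|n|μ} ≤ W_n(β) ≤ β^{|n|μ}` for `0 < β ≤ 2`. -/
theorem stmt_5 (μ : ℝ) (hμ : 1 < μ)
    (η : ℝ → ℝ) (hη_smooth : ContDiff ℝ (⊤ : ℕ∞) η)
    (hη_range : ∀ β, 0 ≤ η β ∧ η β ≤ 1)
    (hη0 : ∀ β : ℝ, β ≤ 1 → η β = 0) (hη1 : ∀ β : ℝ, 2 ≤ β → η β = 1) :
    ∀ n : ℤ, n ≠ 0 →
      (∀ β : ℝ, 2 ≤ β →
        WFun μ η n β = CConst μ η n * β ^ (Real.sqrt ((n : ℝ) ^ 2 * μ ^ 2 - 2 * μ + 1))) ∧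
      (1 ≤ CConst μ η n ∧ CConst μ η n ≤ 2) ∧
      (∀ β : ℝ, 1 ≤ β →
        β ^ (Real.sqrt ((n : ℝ) ^ 2 * μ ^ 2 - 2 * μ + 1)) ≤ WFun μ η n β ∧
        WFun μ η n β ≤ 2 * β ^ (Real.sqrt ((n : ℝ) ^ 2 * μ ^ 2 - 2 * μ + 1))) ∧
      (∀ β : ℝ, 0 < β → β ≤ 2 →
        (1 / 2) * β ^ (|(n : ℝ)| * μ) ≤ WFun μ η n β ∧ WFun μ η n β ≤ β ^ (|(n : ℝ)| * μ)) := by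
  intro n hn
  have hη := hη_smooth.continuous
  have ha := continuous_aFun μ hη n
  have hmem := fun b => aFun_mem_Icc hμ n (hη_range b)
  have hgap := abs_mul_le_sqrt_add_one hμ hn
  set r := Real.sqrt ((n : ℝ) ^ 2 * μ ^ 2 - 2 * μ + 1) with hr
  have hC : CConst μ η n = Real.exp (∫ b in (1 : ℝ)..2, (aFun μ η n b - r) / b) := rfl
  have hlower : ∀ β : ℝ, 1 ≤ β →
      (∫ b in (1 : ℝ)..β, (aFun μ η n b - r) / b) ∈ Icc 0 (Real.log β) := by
    intro β hβ
    have h := integral_div_id_mem_Icc (ha.sub continuous_const) (l := 0) (u := 1) hβ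
      (f := fun b => aFun μ η n b - r)
      fun x => ⟨by linarith [(hmem x).1], by linarith [(hmem x).2]⟩
    simpa only [zero_mul, one_mul] using h
  have htail : ∀ β : ℝ, 2 ≤ β →
      WFun μ η n β = CConst μ η n * β ^ r := by
    intro β hβ
    have hβ0 : 0 < β := by linarith
    have hi : ∀ {x y : ℝ}, 0 < x → 0 < y → IntervalIntegrable
        (fun b => (aFun μ η n b - r) / b) MeasureTheory.volume x y :=
      fun hx hy => intervalIntegrable_div_id (ha.sub continuous_const) hx hy
    have hzero : (∫ b in (2 : ℝ)..β, (aFun μ η n b - r) / b) = 0 := by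
      refine integral_zero_ae (Eventually.of_forall fun b hb => ?_)
      rw [uIoc_of_le hβ] at hb
      have hab : aFun μ η n b = r := by
        rw [aFun, hη1 b hb.1.le, hr]
        congr 1
        ring
      rw [hab, sub_self, zero_div]
    rw [WFun_eq_exp_mul_rpow μ hη n r hβ0, hC,
      ← integral_add_adjacent_intervals (hi one_pos two_pos) (hi two_pos hβ0), hzero, add_zero]
  have hCb : 1 ≤ CConst μ η n ∧ CConst μ η n ≤ 2 := by
    have h := hlower 2 one_le_two
    rw [hC]
    exact ⟨Real.one_le_exp h.1, (Real.le_log_iff_exp_le two_pos).mp h.2⟩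
  refine ⟨htail, hCb, fun β hβ => ?_, fun β hβ0 hβ2 => ?_⟩
  · have hβ0 : 0 < β := by linarith
    have hp : 0 < β ^ r := Real.rpow_pos_of_pos hβ0 r
    rcases le_total β 2 with h2 | h2
    · have h := hlower β hβ
      have hle := (Real.le_log_iff_exp_le hβ0).mp h.2
      rw [WFun_eq_exp_mul_rpow μ hη n r hβ0]
      exact ⟨le_mul_of_one_le_left hp.le (Real.one_le_exp h.1),
        mul_le_mul_of_nonneg_right (hle.trans h2) hp.le⟩
    · rw [htail β h2]
      exact ⟨le_mul_of_one_le_left hp.le hCb.1, mul_le_mul_of_nonneg_right hCb.2 hp.le⟩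
  · have hp : 0 < β ^ (|(n : ℝ)| * μ) := Real.rpow_pos_of_pos hβ0 _
    rw [WFun_eq_exp_mul_rpow μ hη n (|(n : ℝ)| * μ) hβ0]
    suffices h : (∫ b in (1 : ℝ)..β, (aFun μ η n b - |(n : ℝ)| * μ) / b)
        ∈ Icc (-Real.log 2) 0 by
      refine ⟨mul_le_mul_of_nonneg_right ?_ hp.le,
        mul_le_of_le_one_left hp.le (Real.exp_le_one_iff.mpr h.2)⟩
      have he := Real.exp_le_exp.mpr h.1
      rwa [Real.exp_neg, Real.exp_log two_pos, inv_eq_one_div] at he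
    rcases le_total β 1 with h1 | h1
    · have hzero : (∫ b in (1 : ℝ)..β, (aFun μ η n b - |(n : ℝ)| * μ) / b) = 0 := by
        refine integral_zero_ae (Eventually.of_forall fun b hb => ?_)
        rw [uIoc_of_ge h1] at hb
        have hab : aFun μ η n b = |(n : ℝ)| * μ := by
          rw [aFun, hη0 b hb.2, mul_zero, sub_zero, ← mul_pow, Real.sqrt_sq_eq_abs, abs_mul,
            abs_of_pos (show 0 < μ by linarith)]
        rw [hab, sub_self, zero_div]
      rw [hzero]
      exact ⟨neg_nonpos.mpr (Real.log_nonneg one_le_two), le_rfl⟩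
    · have h := integral_div_id_mem_Icc (ha.sub continuous_const) (l := -1) (u := 0) h1
        (f := fun b => aFun μ η n b - |(n : ℝ)| * μ)
        fun x => ⟨by linarith [(hmem x).1], by linarith [(hmem x).2]⟩
      have hlog := Real.log_le_log hβ0 hβ2
      exact ⟨by linarith [h.1], by linarith [h.2]⟩
end

section
/- Define L_0^{−1}f(β) = β^{2μ−1}∫_β^∞ b^{−2μ} f(b) db for f ∈ 𝒞. Then: (i) for every f ∈ 𝒞, L_0^{−1}f ∈ 𝒞 with lim_{β→0+} L_0^{−1}f(β) = f(0)/(2μ−1) and lim_{β→∞} L_0^{−1}f(β) = f(∞)/(2μ−1); (ii) for every f ∈ 𝒞^δ, L_0^{−1}f ∈ 𝒞^δ and ‖L_0^{−1}f‖_{𝒞^δ} ≤ (2μ−1)^{−1}‖f‖_{𝒞^δ}. -/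
open Filter Topology Set MeasureTheory

/-- sup norm over `[0,∞)`. -/
noncomputable def supN (f : ℝ → ℂ) : ℝ := ⨆ β : Ici (0 : ℝ), ‖f (β : ℝ)‖

/-- sup norm over `(0,∞)`. -/
noncomputable def supNIoi (f : ℝ → ℂ) : ℝ := ⨆ β : Ioi (0 : ℝ), ‖f (β : ℝ)‖

/-- weighted seminorm `sup_{β>0} β^δ ‖f(β) − L‖`. -/
noncomputable def hoel (δ : ℝ) (f : ℝ → ℂ) (L : ℂ) : ℝ :=
  ⨆ β : Ioi (0 : ℝ), (β : ℝ) ^ δ * ‖f (β : ℝ) - L‖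

/-- `L_0^{-1} f (β) = β^{2μ-1} ∫_β^∞ b^{-2μ} f(b) db`. -/
noncomputable def L0inv (μ : ℝ) (f : ℝ → ℂ) (β : ℝ) : ℂ :=
  ((β ^ (2 * μ - 1) : ℝ) : ℂ) * ∫ b in Ioi β, ((b ^ (-(2 * μ)) : ℝ) : ℂ) * f b

/-- The power `s ^ (-2μ)` is integrable on `(1,∞)`. -/
lemma integrableOn_rpow_neg_two_mul {μ : ℝ} (hμ : 1 < μ) :
    IntegrableOn (fun s : ℝ => s ^ (-(2 * μ))) (Ioi 1) :=
  integrableOn_Ioi_rpow_of_lt (by linarith) one_pos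

lemma integral_rpow_neg_two_mul {μ : ℝ} (hμ : 1 < μ) :
    ∫ s in Ioi (1 : ℝ), s ^ (-(2 * μ)) = (2 * μ - 1)⁻¹ := by
  rw [integral_Ioi_rpow_of_lt (by linarith) one_pos, Real.one_rpow, neg_div, ← div_neg, one_div]
  congr 1
  ring

lemma integral_rpow_neg_two_mul_mul_const {μ : ℝ} (hμ : 1 < μ) (c : ℂ) :
    ∫ s in Ioi (1 : ℝ), ((s ^ (-(2 * μ)) : ℝ) : ℂ) * c = c / ((2 * μ - 1 : ℝ) : ℂ) := by
  rw [integral_mul_const, integral_complex_ofReal, integral_rpow_neg_two_mul hμ,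
    Complex.ofReal_inv, div_eq_inv_mul]

lemma norm_integral_rpow_neg_two_mul_mul_le {μ C : ℝ} (hμ : 1 < μ) {h : ℝ → ℂ}
    (hC : ∀ s, 1 < s → ‖h s‖ ≤ C) :
    ‖∫ s in Ioi (1 : ℝ), ((s ^ (-(2 * μ)) : ℝ) : ℂ) * h s‖ ≤ (2 * μ - 1)⁻¹ * C := by
  rw [← integral_rpow_neg_two_mul hμ, ← integral_mul_const]
  refine norm_integral_le_of_norm_le ((integrableOn_rpow_neg_two_mul hμ).mul_const C) ?_
  filter_upwards [ae_restrict_mem measurableSet_Ioi] with s hs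
  have hs0 : (0 : ℝ) ≤ s ^ (-(2 * μ)) := Real.rpow_nonneg (zero_le_one.trans (le_of_lt hs)) _
  rw [norm_mul, Complex.norm_real, Real.norm_of_nonneg hs0]
  exact mul_le_mul_of_nonneg_left (hC s hs) hs0

/-- Scaling `b = β s` turns `L_0^{-1} f` into an integral over a fixed domain. -/
lemma L0inv_eq_integral (μ : ℝ) (f : ℝ → ℂ) {β : ℝ} (hβ : 0 < β) :
    L0inv μ f β = ∫ s in Ioi (1 : ℝ), ((s ^ (-(2 * μ)) : ℝ) : ℂ) * f (β * s) := by
  have h := integral_comp_mul_left_Ioi (fun b => ((b ^ (-(2 * μ)) : ℝ) : ℂ) * f b) 1 hβ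
  rw [mul_one] at h
  have h2 : ∫ b in Ioi β, ((b ^ (-(2 * μ)) : ℝ) : ℂ) * f b
      = β • ∫ s in Ioi (1 : ℝ), (((β * s) ^ (-(2 * μ)) : ℝ) : ℂ) * f (β * s) := by
    rw [h, smul_smul, mul_inv_cancel₀ hβ.ne', one_smul]
  rw [L0inv, h2, Complex.real_smul, ← mul_assoc, ← integral_const_mul]
  refine setIntegral_congr_fun measurableSet_Ioi fun s hs => ?_
  have hs0 : (0 : ℝ) ≤ s := zero_le_one.trans (le_of_lt hs)
  have hp : β ^ (2 * μ - 1) * β * (β * s) ^ (-(2 * μ)) = s ^ (-(2 * μ)) := by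
    rw [Real.mul_rpow hβ.le hs0, ← Real.rpow_add_one hβ.ne', ← mul_assoc, ← Real.rpow_add hβ]
    simp
  rw [← hp]
  push_cast
  ring

lemma exists_norm_le_of_continuousOn_Ici {f : ℝ → ℂ} {L : ℂ} (hf : ContinuousOn f (Ici 0))
    (hL : Tendsto f atTop (𝓝 L)) : ∃ M, ∀ x, 0 ≤ x → ‖f x‖ ≤ M := by
  obtain ⟨A, hA⟩ := eventually_atTop.1 (hL.norm.eventually_le_const (lt_add_one ‖L‖))
  obtain ⟨C, hC⟩ := isCompact_Icc.exists_bound_of_continuousOn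
    (hf.mono (Icc_subset_Ici_self : Icc 0 A ⊆ Ici 0))
  refine ⟨max C (‖L‖ + 1), fun x hx => ?_⟩
  rcases le_total x A with h | h
  · exact (hC x ⟨hx, h⟩).trans (le_max_left _ _)
  · exact (hA x h).trans (le_max_right _ _)

lemma aestronglyMeasurable_rpow_mul_comp_mul (μ : ℝ) {f : ℝ → ℂ}
    (hf : ContinuousOn f (Ici 0)) {β : ℝ} (hβ : 0 ≤ β) :
    AEStronglyMeasurable (fun s : ℝ => ((s ^ (-(2 * μ)) : ℝ) : ℂ) * f (β * s))
      (volume.restrict (Ioi 1)) := by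
  refine ContinuousOn.aestronglyMeasurable (ContinuousOn.mul ?_ ?_) measurableSet_Ioi
  · refine Complex.continuous_ofReal.comp_continuousOn ?_
    exact continuousOn_id.rpow_const fun s hs => Or.inl (zero_lt_one.trans hs).ne'
  · exact hf.comp (by fun_prop) fun s hs => mul_nonneg hβ (zero_le_one.trans (le_of_lt hs))

lemma norm_rpow_mul_comp_mul_le (μ : ℝ) {f : ℝ → ℂ} {M : ℝ} (hM : ∀ x, 0 ≤ x → ‖f x‖ ≤ M)
    {β s : ℝ} (hβ : 0 ≤ β) (hs : 1 < s) :
    ‖((s ^ (-(2 * μ)) : ℝ) : ℂ) * f (β * s)‖ ≤ s ^ (-(2 * μ)) * M := by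
  have hs0 : 0 ≤ s := by linarith
  have hp : 0 ≤ s ^ (-(2 * μ)) := Real.rpow_nonneg hs0 _
  rw [norm_mul, Complex.norm_real, Real.norm_of_nonneg hp]
  exact mul_le_mul_of_nonneg_left (hM _ (mul_nonneg hβ hs0)) hp

/-- Dominated convergence for `L_0^{-1} f` along a filter on the positive half-line. -/
lemma tendsto_L0inv {μ : ℝ} (hμ : 1 < μ) {f : ℝ → ℂ} {L : ℂ} (hf : ContinuousOn f (Ici 0))
    (hL : Tendsto f atTop (𝓝 L)) {l : Filter ℝ} [l.IsCountablyGenerated]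
    (hl : ∀ᶠ β in l, 0 < β) {c : ℝ → ℂ}
    (hc : ∀ s, 1 < s → Tendsto (fun β => f (β * s)) l (𝓝 (c s))) :
    Tendsto (L0inv μ f) l
      (𝓝 (∫ s in Ioi (1 : ℝ), ((s ^ (-(2 * μ)) : ℝ) : ℂ) * c s)) := by
  obtain ⟨M, hM⟩ := exists_norm_le_of_continuousOn_Ici hf hL
  have h : Tendsto (fun β => ∫ s in Ioi (1 : ℝ), ((s ^ (-(2 * μ)) : ℝ) : ℂ) * f (β * s)) l
      (𝓝 (∫ s in Ioi (1 : ℝ), ((s ^ (-(2 * μ)) : ℝ) : ℂ) * c s)) := by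
    refine tendsto_integral_filter_of_dominated_convergence (fun s => s ^ (-(2 * μ)) * M) ?_ ?_
      ((integrableOn_rpow_neg_two_mul hμ).mul_const M) ?_
    · filter_upwards [hl] with β hβ
      exact aestronglyMeasurable_rpow_mul_comp_mul μ hf hβ.le
    · filter_upwards [hl] with β hβ
      filter_upwards [ae_restrict_mem measurableSet_Ioi] with s hs
      exact norm_rpow_mul_comp_mul_le μ hM hβ.le hs
    · filter_upwards [ae_restrict_mem measurableSet_Ioi] with s hs
      exact (hc s hs).const_mul _
  refine h.congr' ?_
  filter_upwards [hl] with β hβ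
  exact (L0inv_eq_integral μ f hβ).symm

lemma continuousOn_L0inv {μ : ℝ} (hμ : 1 < μ) {f : ℝ → ℂ} {L : ℂ} (hf : ContinuousOn f (Ici 0))
    (hL : Tendsto f atTop (𝓝 L)) : ContinuousOn (L0inv μ f) (Ioi 0) := by
  intro β hβ
  rw [ContinuousWithinAt, L0inv_eq_integral μ f hβ]
  refine tendsto_L0inv hμ hf hL self_mem_nhdsWithin fun s hs => ?_
  have hpos : 0 < β * s := mul_pos hβ (zero_lt_one.trans hs)
  refine ((hf.continuousAt (Ici_mem_nhds hpos)).tendsto.comp ?_).mono_left nhdsWithin_le_nhds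
  exact (continuous_id.mul continuous_const).tendsto β

lemma tendsto_L0inv_zero {μ : ℝ} (hμ : 1 < μ) {f : ℝ → ℂ} {L : ℂ}
    (hf : ContinuousOn f (Ici 0)) (hL : Tendsto f atTop (𝓝 L)) :
    Tendsto (L0inv μ f) (𝓝[>] 0) (𝓝 (f 0 / ((2 * μ - 1 : ℝ) : ℂ))) := by
  rw [← integral_rpow_neg_two_mul_mul_const hμ]
  refine tendsto_L0inv hμ hf hL self_mem_nhdsWithin fun s hs => ?_
  refine (hf 0 self_mem_Ici).tendsto.comp (tendsto_nhdsWithin_iff.2 ⟨?_, ?_⟩)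
  · have h : Tendsto (fun β : ℝ => β * s) (𝓝 0) (𝓝 (0 * s)) :=
      (continuous_id.mul continuous_const).tendsto 0
    rw [zero_mul] at h
    exact h.mono_left nhdsWithin_le_nhds
  · filter_upwards [self_mem_nhdsWithin] with β hβ
    exact mul_nonneg (le_of_lt hβ) (by linarith)

lemma tendsto_L0inv_atTop {μ : ℝ} (hμ : 1 < μ) {f : ℝ → ℂ} {L : ℂ}
    (hf : ContinuousOn f (Ici 0)) (hL : Tendsto f atTop (𝓝 L)) :
    Tendsto (L0inv μ f) atTop (𝓝 (L / ((2 * μ - 1 : ℝ) : ℂ))) := by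
  rw [← integral_rpow_neg_two_mul_mul_const hμ]
  exact tendsto_L0inv hμ hf hL (eventually_gt_atTop 0) fun s hs =>
    hL.comp (tendsto_id.atTop_mul_const (zero_lt_one.trans hs))

lemma norm_L0inv_le {μ : ℝ} (hμ : 1 < μ) {f : ℝ → ℂ} {M β : ℝ}
    (hM : ∀ x, 0 ≤ x → ‖f x‖ ≤ M) (hβ : 0 < β) :
    ‖L0inv μ f β‖ ≤ (2 * μ - 1)⁻¹ * M := by
  rw [L0inv_eq_integral μ f hβ]
  exact norm_integral_rpow_neg_two_mul_mul_le hμ fun s hs => hM _ (by positivity)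

lemma L0inv_sub_eq_integral {μ : ℝ} (hμ : 1 < μ) {f : ℝ → ℂ} {L : ℂ}
    (hf : ContinuousOn f (Ici 0)) (hL : Tendsto f atTop (𝓝 L)) {β : ℝ} (hβ : 0 < β) :
    L0inv μ f β - L / ((2 * μ - 1 : ℝ) : ℂ) =
      ∫ s in Ioi (1 : ℝ), ((s ^ (-(2 * μ)) : ℝ) : ℂ) * (f (β * s) - L) := by
  obtain ⟨M, hM⟩ := exists_norm_le_of_continuousOn_Ici hf hL
  rw [L0inv_eq_integral μ f hβ, ← integral_rpow_neg_two_mul_mul_const hμ, ← integral_sub]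
  · simp only [mul_sub]
  · refine ((integrableOn_rpow_neg_two_mul hμ).mul_const M).mono'
      (aestronglyMeasurable_rpow_mul_comp_mul μ hf hβ.le) ?_
    filter_upwards [ae_restrict_mem measurableSet_Ioi] with s hs
    exact norm_rpow_mul_comp_mul_le μ hM hβ.le hs
  · exact (integrableOn_rpow_neg_two_mul hμ).ofReal.mul_const L

lemma rpow_mul_norm_L0inv_sub_le {μ δ : ℝ} (hμ : 1 < μ) (hδ : 0 ≤ δ) {f : ℝ → ℂ} {L : ℂ}
    (hf : ContinuousOn f (Ici 0)) (hL : Tendsto f atTop (𝓝 L)) {H β : ℝ}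
    (hH : ∀ x, 0 < x → x ^ δ * ‖f x - L‖ ≤ H) (hβ : 0 < β) :
    β ^ δ * ‖L0inv μ f β - L / ((2 * μ - 1 : ℝ) : ℂ)‖ ≤ (2 * μ - 1)⁻¹ * H := by
  have hp : 0 < β ^ δ := Real.rpow_pos_of_pos hβ δ
  have h : ‖L0inv μ f β - L / ((2 * μ - 1 : ℝ) : ℂ)‖ ≤ (2 * μ - 1)⁻¹ * (H / β ^ δ) := by
    rw [L0inv_sub_eq_integral hμ hf hL hβ]
    refine norm_integral_rpow_neg_two_mul_mul_le hμ fun s hs => ?_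
    rw [le_div_iff₀' hp]
    refine le_trans ?_ (hH (β * s) (by positivity))
    gcongr
    exact le_mul_of_one_le_right hβ.le hs.le
  calc β ^ δ * ‖L0inv μ f β - L / ((2 * μ - 1 : ℝ) : ℂ)‖
      ≤ β ^ δ * ((2 * μ - 1)⁻¹ * (H / β ^ δ)) := by gcongr
    _ = (2 * μ - 1)⁻¹ * H := by field_simp

/-- Boundedness of `L_0^{-1}` on `𝒞` and on `𝒞^δ`. -/
theorem stmt_6 (μ δ : ℝ) (hμ : 1 < μ)
    (hδ0 : 0 < δ)
    (hδ1 : δ < min (Real.sqrt (4 * μ ^ 2 - 2 * μ + 1) - 2 * μ + 1) 1) :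
    (∀ (f : ℝ → ℂ) (L : ℂ), ContinuousOn f (Ici 0) → Tendsto f atTop (nhds L) →
      ContinuousOn (L0inv μ f) (Ioi 0) ∧
      Tendsto (L0inv μ f) (nhdsWithin 0 (Ioi 0)) (nhds (f 0 / ((2 * μ - 1 : ℝ) : ℂ))) ∧
      Tendsto (L0inv μ f) atTop (nhds (L / ((2 * μ - 1 : ℝ) : ℂ)))) ∧
    (∀ (f : ℝ → ℂ) (L : ℂ), ContinuousOn f (Ici 0) → Tendsto f atTop (nhds L) →
      BddAbove (Set.range fun β : Ioi (0 : ℝ) => (β : ℝ) ^ δ * ‖f (β : ℝ) - L‖) →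
      BddAbove (Set.range fun β : Ioi (0 : ℝ) =>
        (β : ℝ) ^ δ * ‖L0inv μ f (β : ℝ) - L / ((2 * μ - 1 : ℝ) : ℂ)‖) ∧
      supNIoi (L0inv μ f) + hoel δ (L0inv μ f) (L / ((2 * μ - 1 : ℝ) : ℂ)) ≤
        (2 * μ - 1)⁻¹ * (supN f + hoel δ f L)) := by
  refine ⟨fun f L hf hL => ⟨continuousOn_L0inv hμ hf hL, tendsto_L0inv_zero hμ hf hL,
    tendsto_L0inv_atTop hμ hf hL⟩, fun f L hf hL hB => ?_⟩
  have hH : ∀ x, 0 < x → x ^ δ * ‖f x - L‖ ≤ hoel δ f L := fun x hx =>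
    le_ciSup hB (⟨x, hx⟩ : Ioi (0 : ℝ))
  obtain ⟨M, hM⟩ := exists_norm_le_of_continuousOn_Ici hf hL
  have hS : ∀ x, 0 ≤ x → ‖f x‖ ≤ supN f := fun x hx =>
    le_ciSup (f := fun β : Ici (0 : ℝ) => ‖f β‖) ⟨M, by rintro _ ⟨β, rfl⟩; exact hM β β.2⟩
      (⟨x, hx⟩ : Ici (0 : ℝ))
  refine ⟨⟨(2 * μ - 1)⁻¹ * hoel δ f L, ?_⟩, ?_⟩
  · rintro _ ⟨β, rfl⟩
    exact rpow_mul_norm_L0inv_sub_le hμ hδ0.le hf hL hH β.2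
  · rw [mul_add]
    exact add_le_add (ciSup_le fun β => norm_L0inv_le hμ hS β.2)
      (ciSup_le fun β => rpow_mul_norm_L0inv_sub_le hμ hδ0.le hf hL hH β.2)
end
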